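/- Let w ∈ S_n and let x_w, x̃_w ∈ N^w. Then x_w w⁻¹ and x̃_w w⁻¹ admit Gaussian decompositions, the element n₁ = w⁻¹ ([x̃_w w⁻¹]_+)⁻¹ [x_w w⁻¹]_+ w belongs to N_-(w), the product x̃_w n₁ admits a Gaussian decomposition, and [x̃_w n₁]_+ = x_w. Moreover, n₁ is the unique element of N_-(w) satisfying x̃_w n₁ ∈ G_0 and [x̃_w n₁]_+ = x_w. -/

import Mathlib

open scoped Classical

namespace BruhatTNN

abbrev Mat (n : ℕ) := Matrix (Fin n) (Fin n) ℝ

/-- `x` is upper unitriangular. -/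
def upperUni {n : ℕ} (x : Mat n) : Prop :=
  (∀ i, x i i = 1) ∧ ∀ i j : Fin n, j < i → x i j = 0

/-- `x` is lower unitriangular. -/
def lowerUni {n : ℕ} (x : Mat n) : Prop :=
  (∀ i, x i i = 1) ∧ ∀ i j : Fin n, i < j → x i j = 0

/-- `x` is invertible upper triangular (`x ∈ B`). -/
def upperTriInv {n : ℕ} (x : Mat n) : Prop :=
  IsUnit x.det ∧ ∀ i j : Fin n, j < i → x i j = 0

/-- `x` is invertible lower triangular (`x ∈ B_-`). -/
def lowerTriInv {n : ℕ} (x : Mat n) : Prop :=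
  IsUnit x.det ∧ ∀ i j : Fin n, i < j → x i j = 0

/-- `x` is invertible diagonal (`x ∈ H`). -/
def diagInv {n : ℕ} (x : Mat n) : Prop :=
  IsUnit x.det ∧ ∀ i j : Fin n, i ≠ j → x i j = 0

/-- `x` admits a Gaussian decomposition (`x ∈ G_0`). -/
def hasGauss {n : ℕ} (x : Mat n) : Prop :=
  ∃ a d b : Mat n, lowerUni a ∧ diagInv d ∧ upperUni b ∧ x = a * d * b

/-- The factor `[x]_-` of the Gaussian decomposition (junk value `1` if none exists). -/
noncomputable def gaussMinus {n : ℕ} (x : Mat n) : Mat n :=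
  if h : hasGauss x then h.choose else 1

/-- The factor `[x]_0` of the Gaussian decomposition (junk value `1` if none exists). -/
noncomputable def gaussDiag {n : ℕ} (x : Mat n) : Mat n :=
  if h : hasGauss x then h.choose_spec.choose else 1

/-- The factor `[x]_+` of the Gaussian decomposition (junk value `1` if none exists). -/
noncomputable def gaussPlus {n : ℕ} (x : Mat n) : Mat n :=
  if h : hasGauss x then h.choose_spec.choose_spec.choose else 1

/-- The permutation matrix of `w`, with entry `1` in position `(w j, j)`. -/
def permMat {n : ℕ} (w : Equiv.Perm (Fin n)) : Mat n :=
  Matrix.of fun i j => if i = w j then (1 : ℝ) else 0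

/-- The minor of `x` with row set `I` and column set `J` (taken in increasing order). -/
def minorOf {n : ℕ} (x : Mat n) (k : ℕ) (I J : Finset (Fin n))
    (hI : I.card = k) (hJ : J.card = k) : ℝ :=
  Matrix.det (Matrix.of fun a b : Fin k => x (I.orderEmbOfFin hI a) (J.orderEmbOfFin hJ b))

/-- `x` is totally nonnegative: all its minors are nonnegative. -/
def totNonneg {n : ℕ} (x : Mat n) : Prop :=
  ∀ (k : ℕ) (I J : Finset (Fin n)) (hI : I.card = k) (hJ : J.card = k),
    0 ≤ minorOf x k I J hI hJ

/-- The Bruhat order on the symmetric group. -/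
def bruhatLE {n : ℕ} (u v : Equiv.Perm (Fin n)) : Prop :=
  ∀ i j : Fin n,
    (Finset.univ.filter fun k : Fin n => k ≤ i ∧ j ≤ u k).card ≤
    (Finset.univ.filter fun k : Fin n => k ≤ i ∧ j ≤ v k).card

/-- The double coset `B_- w B_-`. -/
def doubleCosetBm {n : ℕ} (w : Equiv.Perm (Fin n)) : Set (Mat n) :=
  {x | ∃ b₁ b₂ : Mat n, lowerTriInv b₁ ∧ lowerTriInv b₂ ∧ x = b₁ * permMat w * b₂}

/-- `N^w = B_- w B_- ∩ N`. -/
def Ncell {n : ℕ} (w : Equiv.Perm (Fin n)) : Set (Mat n) :=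
  {x | upperUni x ∧ x ∈ doubleCosetBm w}

/-- `N_-(w) = w⁻¹ N w ∩ N_-`. -/
def Nminus {n : ℕ} (w : Equiv.Perm (Fin n)) : Set (Mat n) :=
  {x | lowerUni x ∧ ∃ y : Mat n, upperUni y ∧ x = permMat w⁻¹ * y * permMat w}

/-- `N(w) = w⁻¹ N w ∩ N`. -/
def Ngrp {n : ℕ} (w : Equiv.Perm (Fin n)) : Set (Mat n) :=
  {x | upperUni x ∧ ∃ y : Mat n, upperUni y ∧ x = permMat w⁻¹ * y * permMat w}

/-- The totally positive cell `Y°_w = Y ∩ B_- w B_-`. -/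
def Ycirc {n : ℕ} (w : Equiv.Perm (Fin n)) : Set (Mat n) :=
  {x | upperUni x ∧ totNonneg x ∧ x ∈ doubleCosetBm w}

/-- `Y_{≥ u} = ⋃_{v ≥ u} Y°_v`. -/
def Yge {n : ℕ} (u : Equiv.Perm (Fin n)) : Set (Mat n) :=
  {x | ∃ v, bruhatLE u v ∧ x ∈ Ycirc v}

/-- `A = u⁻¹ [x u⁻¹]_+ u`. -/
noncomputable def Amat {n : ℕ} (u : Equiv.Perm (Fin n)) (x : Mat n) : Mat n :=
  permMat u⁻¹ * gaussPlus (x * permMat u⁻¹) * permMat u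

/-- The projection `π_u(x) = [u [u⁻¹ [x u⁻¹]_+ u]_-]_+`. -/
noncomputable def piMap {n : ℕ} (u : Equiv.Perm (Fin n)) (x : Mat n) : Mat n :=
  gaussPlus (permMat u * gaussMinus (Amat u x))

/-- `str(M)`: the sum of the matrix entries immediately above the main diagonal. -/
def strAbove {n : ℕ} (M : Mat n) : ℝ :=
  ∑ p : Fin n × Fin n, if (p.1 : ℕ) + 1 = (p.2 : ℕ) then M p.1 p.2 else 0

/-- The number of inversions (the length) of a permutation. -/
def invNum {n : ℕ} (w : Equiv.Perm (Fin n)) : ℕ :=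
  (Finset.univ.filter fun p : Fin n × Fin n => p.1 < p.2 ∧ w p.2 < w p.1).card

/-- The determinant of a lower triangular matrix is the product of its diagonal entries. -/
theorem det_of_lower {ι : Type*} [Fintype ι] [DecidableEq ι] [LinearOrder ι]
    {x : Matrix ι ι ℝ} (h : ∀ i j, i < j → x i j = 0) : x.det = ∏ i, x i i :=
  Matrix.det_of_isLowerTriangular x fun i j hij => h i j hij

theorem lowerUni.lowerTriInv {n : ℕ} {x : Mat n} (h : lowerUni x) : lowerTriInv x :=
  ⟨by simp [det_of_lower h.2, h.1], h.2⟩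

theorem lowerTriInv.diag_ne_zero {n : ℕ} {x : Mat n} (h : lowerTriInv x) (i : Fin n) :
    x i i ≠ 0 := by
  have hx := h.1
  rw [det_of_lower h.2, isUnit_iff_ne_zero, Finset.prod_ne_zero_iff] at hx
  exact hx i (Finset.mem_univ i)

theorem lowerTriInv.mul {n : ℕ} {x y : Mat n} (hx : lowerTriInv x) (hy : lowerTriInv y) :
    lowerTriInv (x * y) := by
  refine ⟨by simpa using ⟨hx.1.ne_zero, hy.1.ne_zero⟩, fun i j hij => ?_⟩
  rw [Matrix.mul_apply]
  refine Finset.sum_eq_zero fun k _ => ?_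
  rcases lt_or_ge i k with h | h
  · rw [hx.2 i k h, zero_mul]
  · rw [hy.2 k j (h.trans_lt hij), mul_zero]

theorem lowerTriInv.mul_apply_diag {n : ℕ} {x y : Mat n} (hx : lowerTriInv x)
    (hy : lowerTriInv y) (i : Fin n) : (x * y) i i = x i i * y i i := by
  rw [Matrix.mul_apply]
  refine Finset.sum_eq_single i (fun k _ hk => ?_) (by simp)
  rcases lt_or_gt_of_ne hk with h | h
  · rw [hy.2 k i h, mul_zero]
  · rw [hx.2 i k h, zero_mul]

theorem lowerTriInv.inv {n : ℕ} {x : Mat n} (hx : lowerTriInv x) : lowerTriInv x⁻¹ := by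
  refine ⟨by simpa [Matrix.det_nonsing_inv] using hx.1.ne_zero, fun i j hij => ?_⟩
  let _ := Matrix.invertibleOfIsUnitDet x hx.1
  have h : x.BlockTriangular OrderDual.toDual := fun i j hij => hx.2 i j hij
  exact Matrix.blockTriangular_inv_of_blockTriangular h hij

theorem lowerUni.mul {n : ℕ} {x y : Mat n} (hx : lowerUni x) (hy : lowerUni y) :
    lowerUni (x * y) :=
  ⟨fun i => by rw [hx.lowerTriInv.mul_apply_diag hy.lowerTriInv, hx.1, hy.1, one_mul],
    (hx.lowerTriInv.mul hy.lowerTriInv).2⟩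

theorem lowerUni.inv {n : ℕ} {x : Mat n} (hx : lowerUni x) : lowerUni x⁻¹ := by
  refine ⟨fun i => ?_, hx.lowerTriInv.inv.2⟩
  have h := hx.lowerTriInv.mul_apply_diag hx.lowerTriInv.inv i
  rw [Matrix.mul_nonsing_inv _ hx.lowerTriInv.1, hx.1, one_mul, Matrix.one_apply_eq] at h
  exact h.symm

theorem lowerUni_transpose {n : ℕ} {x : Mat n} : lowerUni x.transpose ↔ upperUni x :=
  and_congr Iff.rfl forall_comm

theorem upperUni.isUnit_det {n : ℕ} {x : Mat n} (hx : upperUni x) : IsUnit x.det := by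
  simpa using (lowerUni_transpose.2 hx).lowerTriInv.1

theorem upperUni.mul {n : ℕ} {x y : Mat n} (hx : upperUni x) (hy : upperUni y) :
    upperUni (x * y) := by
  rw [← lowerUni_transpose, Matrix.transpose_mul]
  exact (lowerUni_transpose.2 hy).mul (lowerUni_transpose.2 hx)

theorem upperUni.inv {n : ℕ} {x : Mat n} (hx : upperUni x) : upperUni x⁻¹ := by
  rw [← lowerUni_transpose, Matrix.transpose_nonsing_inv]
  exact (lowerUni_transpose.2 hx).inv

/-- `B_- ∩ N = {1}`, in the form of uniqueness of `B_- N` factorizations. -/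
theorem upperUni_eq_of_mul_eq_mul {n : ℕ} {b c u v : Mat n} (hb : lowerTriInv b)
    (hc : lowerTriInv c) (hu : upperUni u) (hv : upperUni v) (h : b * u = c * v) : u = v := by
  have key : c⁻¹ * b = v * u⁻¹ := by
    have hbuv : b = c * v * u⁻¹ := by
      rw [← h, Matrix.mul_nonsing_inv_cancel_right _ _ hu.isUnit_det]
    rw [hbuv, Matrix.mul_assoc, Matrix.nonsing_inv_mul_cancel_left _ _ hc.1]
  have hup := hv.mul hu.inv
  have hone : v * u⁻¹ = 1 := by
    ext i j
    rcases lt_trichotomy i j with hij | rfl | hij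
    · rw [← key, (hc.inv.mul hb).2 i j hij, Matrix.one_apply_ne hij.ne]
    · rw [hup.1, Matrix.one_apply_eq]
    · rw [hup.2 i j hij, Matrix.one_apply_ne hij.ne']
  calc u = v * u⁻¹ * u := by rw [hone, Matrix.one_mul]
    _ = v := Matrix.nonsing_inv_mul_cancel_right _ _ hu.isUnit_det

theorem hasGauss_mul {n : ℕ} {b u : Mat n} (hb : lowerTriInv b) (hu : upperUni u) :
    hasGauss (b * u) := by
  refine ⟨b * Matrix.diagonal fun i => (b i i)⁻¹, Matrix.diagonal fun i => b i i, u,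
    ⟨fun i => ?_, fun i j hij => ?_⟩, ⟨?_, fun i j hij => Matrix.diagonal_apply_ne _ hij⟩, hu, ?_⟩
  · rw [Matrix.mul_diagonal, mul_inv_cancel₀ (hb.diag_ne_zero i)]
  · rw [Matrix.mul_diagonal, hb.2 i j hij, zero_mul]
  · rw [Matrix.det_diagonal, ← det_of_lower hb.2]
    exact hb.1
  · rw [Matrix.mul_assoc b, Matrix.diagonal_mul_diagonal]
    simp [hb.diag_ne_zero]

theorem hasGauss.exists_eq_mul_gaussPlus {n : ℕ} {x : Mat n} (h : hasGauss x) :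
    upperUni (gaussPlus x) ∧ ∃ c, lowerTriInv c ∧ x = c * gaussPlus x := by
  obtain ⟨ha, hd, hb, hx⟩ := h.choose_spec.choose_spec.choose_spec
  rw [gaussPlus, dif_pos h]
  exact ⟨hb, _, ha.lowerTriInv.mul ⟨hd.1, fun i j hij => hd.2 i j hij.ne⟩, hx⟩

theorem gaussPlus_mul {n : ℕ} {b u : Mat n} (hb : lowerTriInv b) (hu : upperUni u) :
    gaussPlus (b * u) = u := by
  obtain ⟨hp, c, hc, h⟩ := (hasGauss_mul hb hu).exists_eq_mul_gaussPlus
  exact (upperUni_eq_of_mul_eq_mul hb hc hu hp h).symm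

theorem permMat_mul_apply {n : ℕ} (w : Equiv.Perm (Fin n)) (x : Mat n) (i j : Fin n) :
    (permMat w * x) i j = x (w⁻¹ i) j := by
  have h : ∀ k, i = w k ↔ w⁻¹ i = k := fun k => Equiv.Perm.inv_eq_iff_eq.symm
  simp [Matrix.mul_apply, permMat, h]

theorem mul_permMat_apply {n : ℕ} (w : Equiv.Perm (Fin n)) (x : Mat n) (i j : Fin n) :
    (x * permMat w) i j = x i (w j) := by
  simp [Matrix.mul_apply, permMat]

theorem permMat_mul_inv {n : ℕ} (w : Equiv.Perm (Fin n)) : permMat w * permMat w⁻¹ = 1 := by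
  ext i j
  rw [mul_permMat_apply]
  simp [permMat, Matrix.one_apply]

theorem permMat_inv_mul {n : ℕ} (w : Equiv.Perm (Fin n)) : permMat w⁻¹ * permMat w = 1 := by
  simpa using permMat_mul_inv w⁻¹

/-- Every `b ∈ B_-` can be moved into `w⁻¹ B_- w` by right multiplication with an element of
`N_- ∩ w⁻¹ N w`. -/
theorem exists_lowerUni_conj {n : ℕ} (w : Equiv.Perm (Fin n)) {b : Mat n} (hb : lowerTriInv b) :
    ∃ r : Mat n, lowerUni r ∧ upperUni (permMat w * r * permMat w⁻¹) ∧
      lowerTriInv (permMat w * (b * r) * permMat w⁻¹) := by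
  have hcol : ∀ j : Fin n, ∃ c : Fin n → ℝ, c j = 1 ∧
      (∀ k, k ≠ j → ¬ (j < k ∧ w k < w j) → c k = 0) ∧
      ∀ i, j < i → w i < w j → ∑ k, b i k * c k = 0 := by
    intro j
    let S : Type := {k : Fin n // j < k ∧ w k < w j}
    let M : Matrix S S ℝ := Matrix.of fun i k => b i.1 k.1
    have hM : IsUnit M.det := by
      rw [det_of_lower fun i k hik => hb.2 i.1 k.1 hik, isUnit_iff_ne_zero,
        Finset.prod_ne_zero_iff]
      exact fun i _ => hb.diag_ne_zero i.1
    let v : S → ℝ := M⁻¹.mulVec fun i => -b i.1 j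
    have hv : M.mulVec v = fun i => -b i.1 j := by
      rw [Matrix.mulVec_mulVec, Matrix.mul_nonsing_inv _ hM, Matrix.one_mulVec]
    refine ⟨fun k => if h : j < k ∧ w k < w j then v ⟨k, h⟩ else if k = j then 1 else 0,
      by simp, fun k hk hkS => by simp [hk, hkS], fun i hi hwi => ?_⟩
    have hrow := congrFun hv ⟨i, hi, hwi⟩
    have hsum : ∑ k, b i k * (if h : j < k ∧ w k < w j then v ⟨k, h⟩ else 0) =
        ∑ k : S, b i k.1 * v k := by
      refine (Fintype.sum_of_injective (fun k : S => k.1) Subtype.val_injective _ _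
        (fun k hk => ?_) fun k => ?_).symm
      · rw [dif_neg fun h => hk ⟨⟨k, h⟩, rfl⟩, mul_zero]
      · rw [dif_pos k.2]
    have hsplit : ∀ k, b i k * (if h : j < k ∧ w k < w j then v ⟨k, h⟩ else
        if k = j then 1 else 0) =
        b i k * (if h : j < k ∧ w k < w j then v ⟨k, h⟩ else 0) +
          (if k = j then b i k else 0) := by
      intro k
      by_cases hk : k = j
      · subst hk; simp
      · simp [hk]
    simp only [hsplit, Finset.sum_add_distrib, hsum, Finset.sum_ite_eq', Finset.mem_univ, if_true]
    have hrow' : ∑ k : S, b i k.1 * v k = -b i j := hrow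
    rw [hrow', neg_add_cancel]
  choose c hc1 hc0 hc using hcol
  have hr : lowerUni (Matrix.of fun i j => c j i : Mat n) :=
    ⟨hc1, fun i j hij => hc0 j i hij.ne fun h => h.1.not_gt hij⟩
  refine ⟨Matrix.of fun i j => c j i, hr, ⟨fun i => ?_, fun i j hij => ?_⟩, ?_, fun i j hij => ?_⟩
  · rw [mul_permMat_apply, permMat_mul_apply]
    exact hc1 _
  · rw [mul_permMat_apply, permMat_mul_apply]
    refine hc0 _ _ (fun h => hij.ne' (w⁻¹.injective h)) fun h => ?_
    simp only [Equiv.Perm.coe_inv, Equiv.apply_symm_apply] at h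
    exact h.2.not_gt hij
  · have hdet := congrArg Matrix.det (permMat_mul_inv w)
    rw [Matrix.det_mul, Matrix.det_one] at hdet
    have : (permMat w * (b * Matrix.of fun i j => c j i) * permMat w⁻¹).det =
        (b * Matrix.of fun i j => c j i).det := by
      rw [Matrix.det_mul, Matrix.det_mul, mul_right_comm, hdet, one_mul]
    rw [this]
    exact (hb.mul hr.lowerTriInv).1
  · rw [mul_permMat_apply, permMat_mul_apply]
    rcases lt_trichotomy (w⁻¹ i) (w⁻¹ j) with h | h | h
    · exact (hb.mul hr.lowerTriInv).2 _ _ h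
    · exact absurd (w⁻¹.injective h) hij.ne
    · exact hc _ _ h (by simpa using hij)

/-- `N^w ⊆ B_- w N_-(w)`: every `x ∈ N^w` satisfies `x w⁻¹ = b u` with `b ∈ B_-` and
`u ∈ N ∩ w N_- w⁻¹`. -/
theorem exists_eq_mul_of_mem_Ncell {n : ℕ} {w : Equiv.Perm (Fin n)} {x : Mat n}
    (hx : x ∈ Ncell w) : ∃ b u : Mat n, lowerTriInv b ∧ upperUni u ∧
      lowerUni (permMat w⁻¹ * u * permMat w) ∧ x * permMat w⁻¹ = b * u := by
  obtain ⟨-, b₁, b₂, hb₁, hb₂, rfl⟩ := hx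
  obtain ⟨r, hr, hru, hrl⟩ := exists_lowerUni_conj w hb₂
  have hw := permMat_mul_inv w
  have hw' := permMat_inv_mul w
  have hu : (permMat w * r * permMat w⁻¹)⁻¹ = permMat w * r⁻¹ * permMat w⁻¹ := by
    refine Matrix.inv_eq_right_inv ?_
    calc permMat w * r * permMat w⁻¹ * (permMat w * r⁻¹ * permMat w⁻¹)
        = permMat w * r * (permMat w⁻¹ * permMat w) * r⁻¹ * permMat w⁻¹ := by noncomm_ring
      _ = 1 := by
        rw [hw', Matrix.mul_one, Matrix.mul_nonsing_inv_cancel_right _ _ hr.lowerTriInv.1, hw]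
  refine ⟨b₁ * (permMat w * (b₂ * r) * permMat w⁻¹), _, hb₁.mul hrl, hru.inv, ?_, ?_⟩
  · have : permMat w⁻¹ * (permMat w * r * permMat w⁻¹)⁻¹ * permMat w = r⁻¹ := by
      rw [hu]
      calc permMat w⁻¹ * (permMat w * r⁻¹ * permMat w⁻¹) * permMat w
          = permMat w⁻¹ * permMat w * r⁻¹ * (permMat w⁻¹ * permMat w) := by noncomm_ring
        _ = r⁻¹ := by rw [hw', Matrix.one_mul, Matrix.mul_one]
    rw [this]
    exact hr.inv
  · rw [hu]
    calc b₁ * permMat w * b₂ * permMat w⁻¹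
        = b₁ * permMat w * b₂ * (r * r⁻¹) * permMat w⁻¹ := by
          rw [Matrix.mul_nonsing_inv _ hr.lowerTriInv.1, Matrix.mul_one]
      _ = b₁ * permMat w * b₂ * r * 1 * r⁻¹ * permMat w⁻¹ := by noncomm_ring
      _ = b₁ * (permMat w * (b₂ * r) * permMat w⁻¹) * (permMat w * r⁻¹ * permMat w⁻¹) := by
          rw [← hw']; noncomm_ring

theorem statement4 (n : ℕ) (hn : 1 ≤ n) (w : Equiv.Perm (Fin n)) (xw txw : Mat n)
    (hxw : xw ∈ Ncell w) (htxw : txw ∈ Ncell w) :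
    hasGauss (xw * permMat w⁻¹) ∧
    hasGauss (txw * permMat w⁻¹) ∧
    (permMat w⁻¹ * (gaussPlus (txw * permMat w⁻¹))⁻¹ * gaussPlus (xw * permMat w⁻¹) *
        permMat w) ∈ Nminus w ∧
    hasGauss (txw * (permMat w⁻¹ * (gaussPlus (txw * permMat w⁻¹))⁻¹ *
        gaussPlus (xw * permMat w⁻¹) * permMat w)) ∧
    gaussPlus (txw * (permMat w⁻¹ * (gaussPlus (txw * permMat w⁻¹))⁻¹ *
        gaussPlus (xw * permMat w⁻¹) * permMat w)) = xw ∧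
    (∀ m ∈ Nminus w, hasGauss (txw * m) → gaussPlus (txw * m) = xw →
      m = permMat w⁻¹ * (gaussPlus (txw * permMat w⁻¹))⁻¹ *
        gaussPlus (xw * permMat w⁻¹) * permMat w) := by
  obtain ⟨b, u, hb, hu, hul, hbu⟩ := exists_eq_mul_of_mem_Ncell hxw
  obtain ⟨c, v, hc, hv, hvl, hcv⟩ := exists_eq_mul_of_mem_Ncell htxw
  have hw := permMat_mul_inv w
  have hw' := permMat_inv_mul w
  rw [hbu, hcv, gaussPlus_mul hb hu, gaussPlus_mul hc hv]
  have hx : xw = b * u * permMat w := by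
    rw [← hbu, Matrix.mul_assoc, hw', Matrix.mul_one]
  have hvinv : (permMat w⁻¹ * v * permMat w)⁻¹ = permMat w⁻¹ * v⁻¹ * permMat w := by
    refine Matrix.inv_eq_right_inv ?_
    calc permMat w⁻¹ * v * permMat w * (permMat w⁻¹ * v⁻¹ * permMat w)
        = permMat w⁻¹ * v * (permMat w * permMat w⁻¹) * v⁻¹ * permMat w := by noncomm_ring
      _ = 1 := by
        rw [hw, Matrix.mul_one, Matrix.mul_nonsing_inv_cancel_right _ _ hv.isUnit_det, hw']
  have hmul : txw * (permMat w⁻¹ * v⁻¹ * u * permMat w) = c * b⁻¹ * xw := by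
    calc txw * (permMat w⁻¹ * v⁻¹ * u * permMat w)
        = txw * permMat w⁻¹ * v⁻¹ * u * permMat w := by noncomm_ring
      _ = c * u * permMat w := by
        rw [hcv, Matrix.mul_nonsing_inv_cancel_right _ _ hv.isUnit_det]
      _ = c * (b⁻¹ * b) * u * permMat w := by
        rw [Matrix.nonsing_inv_mul _ hb.1, Matrix.mul_one]
      _ = c * b⁻¹ * xw := by rw [hx]; noncomm_ring
  refine ⟨hasGauss_mul hb hu, hasGauss_mul hc hv, ⟨?_, v⁻¹ * u, hv.inv.mul hu, ?_⟩, ?_, ?_, ?_⟩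
  · have : permMat w⁻¹ * v⁻¹ * u * permMat w =
        (permMat w⁻¹ * v * permMat w)⁻¹ * (permMat w⁻¹ * u * permMat w) := by
      rw [hvinv]
      calc permMat w⁻¹ * v⁻¹ * u * permMat w
          = permMat w⁻¹ * v⁻¹ * 1 * u * permMat w := by rw [Matrix.mul_one]
        _ = _ := by rw [← hw]; noncomm_ring
    rw [this]
    exact hvl.inv.mul hul
  · noncomm_ring
  · rw [hmul]
    exact hasGauss_mul (hc.mul hb.inv) hxw.1
  · rw [hmul]
    exact gaussPlus_mul (hc.mul hb.inv) hxw.1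
  · rintro m ⟨-, y, hy, rfl⟩ hg hgp
    obtain ⟨-, d, hd, hdx⟩ := hg.exists_eq_mul_gaussPlus
    rw [hgp] at hdx
    have huv : v * y = u := by
      refine upperUni_eq_of_mul_eq_mul hc (hd.mul hb) (hv.mul hy) hu ?_
      calc c * (v * y) = txw * permMat w⁻¹ * y * (permMat w * permMat w⁻¹) := by
            rw [hcv, hw]; noncomm_ring
        _ = txw * (permMat w⁻¹ * y * permMat w) * permMat w⁻¹ := by noncomm_ring
        _ = d * b * u * (permMat w * permMat w⁻¹) := by rw [hdx, hx]; noncomm_ring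
        _ = d * b * u := by rw [hw, Matrix.mul_one]
    rw [← huv, Matrix.mul_assoc (permMat w⁻¹) v⁻¹,
      Matrix.nonsing_inv_mul_cancel_left _ _ hv.isUnit_det]

end BruhatTNN
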